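/- (Natarajan's lemma) Let C be a class of functions from a finite set S of size N to [K] with Natarajan dimension at most n. Then |C restricted to S| ≤ N^n · K^{2n}. -/

import Mathlib

/-- `C` N-shatters the set `T`: there are witness functions `f₁ f₂` disagreeing on `T`
such that every subset `B ⊆ T` is realized by some `c ∈ C` agreeing with `f₁` on `B`
and with `f₂` on `T \ B`. -/
def NShatters {N K : ℕ} (C : Set (Fin N → Fin K)) (T : Finset (Fin N)) : Prop :=
  ∃ f₁ f₂ : Fin N → Fin K, (∀ x ∈ T, f₁ x ≠ f₂ x) ∧
    ∀ B : Finset (Fin N), B ⊆ T → ∃ c ∈ C,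
      (∀ x ∈ B, c x = f₁ x) ∧ (∀ x ∈ T, x ∉ B → c x = f₂ x)

theorem nsh_two {N K n : ℕ} (C : Set (Fin N → Fin K))
    (hdim : ∀ T : Finset (Fin N), NShatters C T → T.card ≤ n)
    (c d : Fin N → Fin K) (hc : c ∈ C) (hd : d ∈ C) (hne : c ≠ d) : 1 ≤ n := by
  obtain ⟨x, hx⟩ := Function.ne_iff.mp hne
  have := hdim {x} ⟨c, d, by simpa using hx, ?_⟩
  · simpa using this
  · intro B hB
    by_cases h : x ∈ B
    · refine ⟨c, hc, fun _ _ => rfl, ?_⟩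
      intro y hy hyB
      rw [Finset.mem_singleton] at hy
      subst hy
      exact absurd h hyB
    · refine ⟨d, hd, ?_, fun _ _ _ => rfl⟩
      intro y hy
      have hy' := Finset.mem_singleton.mp (hB hy)
      subst hy'
      exact absurd hy h

theorem nsh_tail {N K : ℕ} (C : Set (Fin (N + 1) → Fin K)) (P : Set (Fin N → Fin K))
    (hP : ∀ p ∈ P, ∃ c ∈ C, Fin.tail c = p) (T : Finset (Fin N)) (h : NShatters P T) :
    NShatters C (T.map (Fin.succEmb N)) := by
  obtain ⟨f₁, f₂, hne, hB⟩ := h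
  obtain ⟨p, hp, -⟩ := hB ∅ (by simp)
  obtain ⟨c₀, -, -⟩ := hP p hp
  refine ⟨Fin.cons (c₀ 0) f₁, Fin.cons (c₀ 0) f₂, ?_, ?_⟩
  · intro x hx
    obtain ⟨y, hy, rfl⟩ := Finset.mem_map.mp hx
    simpa using hne y hy
  · intro B hBT
    obtain ⟨p, hp, h1, h2⟩ := hB (T.filter (fun y => y.succ ∈ B)) (Finset.filter_subset _ _)
    obtain ⟨c, hc, rfl⟩ := hP p hp
    refine ⟨c, hc, ?_, ?_⟩
    · intro x hx
      obtain ⟨y, hy, rfl⟩ := Finset.mem_map.mp (hBT hx)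
      simpa [Fin.tail] using h1 y (Finset.mem_filter.mpr ⟨hy, hx⟩)
    · intro x hx hxB
      obtain ⟨y, hy, rfl⟩ := Finset.mem_map.mp hx
      simpa [Fin.tail] using h2 y hy (fun h => hxB (Finset.mem_filter.mp h).2)

theorem nsh_pair {N K : ℕ} (C : Set (Fin (N + 1) → Fin K)) (P : Set (Fin N → Fin K))
    (a b : Fin K) (hab : a ≠ b)
    (ha : ∀ p ∈ P, (Fin.cons a p : Fin (N + 1) → Fin K) ∈ C)
    (hb : ∀ p ∈ P, (Fin.cons b p : Fin (N + 1) → Fin K) ∈ C)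
    (T : Finset (Fin N)) (h : NShatters P T) :
    NShatters C (insert 0 (T.map (Fin.succEmb N))) := by
  obtain ⟨f₁, f₂, hne, hB⟩ := h
  refine ⟨Fin.cons a f₁, Fin.cons b f₂, ?_, ?_⟩
  · intro x hx
    rcases Finset.mem_insert.mp hx with rfl | hx
    · simpa using hab
    obtain ⟨y, hy, rfl⟩ := Finset.mem_map.mp hx
    simpa using hne y hy
  · intro B hBT
    obtain ⟨p, hp, h1, h2⟩ := hB (T.filter (fun y => y.succ ∈ B)) (Finset.filter_subset _ _)
    refine ⟨Fin.cons (if 0 ∈ B then a else b) p, ?_, ?_, ?_⟩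
    · split_ifs
      · exact ha p hp
      · exact hb p hp
    · intro x hx
      rcases Finset.mem_insert.mp (hBT hx) with rfl | hx'
      · simp [hx]
      obtain ⟨y, hy, rfl⟩ := Finset.mem_map.mp hx'
      simpa using h1 y (Finset.mem_filter.mpr ⟨hy, hx⟩)
    · intro x hx hxB
      rcases Finset.mem_insert.mp hx with rfl | hx'
      · simp [hxB]
      obtain ⟨y, hy, rfl⟩ := Finset.mem_map.mp hx'
      simpa using h2 y hy (fun h => hxB (Finset.mem_filter.mp h).2)

open Classical in
theorem nsh_main (K N : ℕ) : ∀ (n : ℕ) (C : Finset (Fin (N + 1) → Fin K)),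
    (∀ T : Finset (Fin (N + 1)), NShatters (C : Set (Fin (N + 1) → Fin K)) T → T.card ≤ n) →
    C.card ≤ (N + 1) ^ n * K ^ (2 * n) := by
  induction N with
  | zero =>
    intro n C hdim
    rcases Nat.eq_zero_or_pos n with rfl | hn
    · simp only [Nat.mul_zero, pow_zero, mul_one]
      refine Finset.card_le_one.mpr fun c hc d hd => ?_
      by_contra hne
      exact absurd (nsh_two _ hdim c d hc hd hne) (by omega)
    · have h := Finset.card_le_univ C
      simp only [Fintype.card_pi, Fintype.card_fin, Finset.prod_const, Finset.card_univ] at h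
      simp only [zero_add, one_pow, one_mul, pow_one] at h ⊢
      exact h.trans (Nat.le_self_pow (by omega) K)
  | succ N ih =>
    intro n C hdim
    rcases Nat.eq_zero_or_pos n with rfl | hn
    · simp only [Nat.mul_zero, pow_zero, mul_one]
      refine Finset.card_le_one.mpr fun c hc d hd => ?_
      by_contra hne
      exact absurd (nsh_two _ hdim c d hc hd hne) (by omega)
    obtain ⟨m, rfl⟩ : ∃ m, n = m + 1 := ⟨n - 1, by omega⟩
    let P := C.image Fin.tail
    have hP : ∀ p ∈ P, ∃ c ∈ C, Fin.tail c = p := fun p hp => Finset.mem_image.mp hp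
    have hPc : P.card ≤ (N + 1) ^ (m + 1) * K ^ (2 * (m + 1)) := by
      refine ih _ P fun T hT => ?_
      have := hdim _ (nsh_tail (K := K) (↑C) (↑P) (fun p hp => hP p (Finset.mem_coe.mp hp)) T hT)
      simpa using this
    let Q : Fin K × Fin K → Finset (Fin (N + 1) → Fin K) := fun ab =>
      Finset.univ.filter fun p => ab.1 ≠ ab.2 ∧
        (Fin.cons ab.1 p : Fin (N + 2) → Fin K) ∈ C ∧ (Fin.cons ab.2 p : Fin (N + 2) → Fin K) ∈ C
    have hQc : ∀ ab, (Q ab).card ≤ (N + 1) ^ m * K ^ (2 * m) := by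
      intro ab
      by_cases hab : ab.1 = ab.2
      · simp [Q, hab]
      refine ih _ (Q ab) fun T hT => ?_
      have := hdim _ (nsh_pair (C : Set _) (Q ab : Set _) ab.1 ab.2 hab
        (fun p hp => (Finset.mem_filter.mp (Finset.mem_coe.mp hp)).2.2.1)
        (fun p hp => (Finset.mem_filter.mp (Finset.mem_coe.mp hp)).2.2.2) T hT)
      rw [Finset.card_insert_of_notMem (by simp [Fin.succ_ne_zero]), Finset.card_map] at this
      omega
    rcases C.eq_empty_or_nonempty with rfl | ⟨c₀, -⟩
    · simp
    have : Nonempty (Fin (N + 1 + 1) → Fin K) := ⟨c₀⟩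
    choose! s hs using hP
    have hsub : C ⊆ P.image s ∪
        Finset.univ.biUnion (fun ab : Fin K × Fin K =>
          (Q ab).image (fun p => (Fin.cons ab.1 p : Fin (N + 2) → Fin K))) := by
      intro c hc
      have hp : Fin.tail c ∈ P := Finset.mem_image_of_mem _ hc
      obtain ⟨h1, h2⟩ := hs _ hp
      have e1 : (Fin.cons (c 0) (Fin.tail c) : Fin (N + 2) → Fin K) = c := Fin.cons_self_tail c
      have e2 : (Fin.cons (s (Fin.tail c) 0) (Fin.tail c) : Fin (N + 2) → Fin K)
          = s (Fin.tail c) := by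
        conv_lhs => rw [← h2]
        rw [h2]
        conv_rhs => rw [← Fin.cons_self_tail (s (Fin.tail c)), h2]
      by_cases h : c 0 = s (Fin.tail c) 0
      · refine Finset.mem_union_left _ (Finset.mem_image.mpr ⟨_, hp, ?_⟩)
        rw [← e2, ← h, e1]
      · refine Finset.mem_union_right _ (Finset.mem_biUnion.mpr
          ⟨(c 0, s (Fin.tail c) 0), Finset.mem_univ _, Finset.mem_image.mpr ⟨Fin.tail c, ?_, e1⟩⟩)
        refine Finset.mem_filter.mpr ⟨Finset.mem_univ _, h, ?_, ?_⟩
        · simpa only [e1] using hc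
        · simpa only [e2] using h1
    have hb : (Finset.univ.biUnion (fun ab : Fin K × Fin K =>
          (Q ab).image (fun p => (Fin.cons ab.1 p : Fin (N + 2) → Fin K)))).card
          ≤ (K * K) * ((N + 1) ^ m * K ^ (2 * m)) := by
      have := Finset.card_biUnion_le_card_mul (Finset.univ : Finset (Fin K × Fin K))
        (fun ab => (Q ab).image (fun p => (Fin.cons ab.1 p : Fin (N + 2) → Fin K)))
        _ (fun ab _ => Finset.card_image_le.trans (hQc ab))
      simpa using this
    calc C.card ≤ _ := Finset.card_le_card hsub
      _ ≤ _ := Finset.card_union_le _ _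
      _ ≤ (N + 1) ^ (m + 1) * K ^ (2 * (m + 1)) + (K * K) * ((N + 1) ^ m * K ^ (2 * m)) :=
        Nat.add_le_add (Finset.card_image_le.trans hPc) hb
      _ = ((N + 1) ^ m * (N + 1 + 1)) * K ^ (2 * (m + 1)) := by ring
      _ ≤ ((N + 1 + 1) ^ m * (N + 1 + 1)) * K ^ (2 * (m + 1)) := by
        gcongr
        omega
      _ = _ := by ring

/-- Natarajan's lemma: a class of functions from a set of size `N` to `[K]` with
Natarajan dimension at most `n` has cardinality at most `N^n · K^(2n)`. -/
theorem stmt10 {N K n : ℕ} (hN : 0 < N) (C : Set (Fin N → Fin K))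
    (hdim : ∀ T : Finset (Fin N), NShatters C T → T.card ≤ n) :
    Nat.card C ≤ N ^ n * K ^ (2 * n) := by
  classical
  obtain ⟨M, rfl⟩ : ∃ M, N = M + 1 := ⟨N - 1, by omega⟩
  have h := nsh_main K M n C.toFinset (by simpa using hdim)
  rw [Nat.card_eq_fintype_card, ← Set.toFinset_card]
  exact h
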